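/- For an integer m ≥ 4, a rational prime p splits into exactly 2 primes in the cyclotomic field Q(ζ_{2^m}) if and only if p ≡ 3 (mod 8) or p ≡ 5 (mod 8). -/

import Mathlib

open NumberField IntermediateField

/-- Modulo `2 ^ (n + 4)`, the residues of maximal order are those congruent to `±3` modulo `8`. -/
theorem ZMod.orderOf_natCast_two_pow_eq_iff {a : ℕ} (ha : Odd a) (n : ℕ) :
    orderOf (a : ZMod (2 ^ (n + 4))) = 2 ^ (n + 2) ↔ a % 8 = 3 ∨ a % 8 = 5 := by
  constructor
  · intro h
    by_contra hmod
    have hdvd : ∀ j : ℕ, (2 : ℤ) ^ (j + 4) ∣ (a : ℤ) ^ 2 ^ (j + 1) - 1 := by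
      intro j
      induction j with
      | zero =>
        obtain ⟨k, hk⟩ | ⟨k, hk⟩ : (∃ k : ℕ, a = 8 * k + 1) ∨ ∃ k : ℕ, a = 8 * k + 7 := by
          rcases ha with ⟨b, rfl⟩
          rcases (by lia : (2 * b + 1) % 8 = 1 ∨ (2 * b + 1) % 8 = 7) with h | h
          · exact .inl ⟨(2 * b + 1) / 8, by lia⟩
          · exact .inr ⟨(2 * b + 1) / 8, by lia⟩
        · exact ⟨4 * k ^ 2 + k, by rw [hk]; push_cast; ring⟩
        · exact ⟨4 * k ^ 2 + 7 * k + 3, by rw [hk]; push_cast; ring⟩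
      | succ j ih =>
        have hfac : (a : ℤ) ^ 2 ^ (j + 1 + 1) - 1 =
            ((a : ℤ) ^ 2 ^ (j + 1) - 1) * ((a : ℤ) ^ 2 ^ (j + 1) + 1) := by
          rw [pow_succ 2 (j + 1), pow_mul]; ring
        rw [hfac, show j + 1 + 4 = j + 4 + 1 by ring, pow_succ]
        refine mul_dvd_mul ih (even_iff_two_dvd.mp ?_)
        exact ((Int.odd_coe_nat a).mpr ha).pow.add_one
    have hpow : (a : ZMod (2 ^ (n + 4))) ^ 2 ^ (n + 1) = 1 := by
      have := (ZMod.intCast_zmod_eq_zero_iff_dvd _ (2 ^ (n + 4))).mpr (by exact_mod_cast hdvd n)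
      push_cast at this
      exact sub_eq_zero.mp this
    have hle := Nat.le_of_dvd (by positivity) (orderOf_dvd_of_pow_eq_one hpow)
    rw [h] at hle
    exact absurd hle (not_le.mpr (Nat.pow_lt_pow_right one_lt_two (by lia)))
  · intro hmod
    obtain ⟨c, hc, hsq⟩ : ∃ c : ℤ, Odd c ∧ (a : ℤ) ^ 2 = 1 + 2 ^ 3 * c := by
      rcases hmod with h | h
      · obtain ⟨k, hk⟩ : ∃ k : ℕ, a = 8 * k + 3 := ⟨a / 8, by lia⟩
        exact ⟨8 * k ^ 2 + 6 * k + 1, ⟨4 * k ^ 2 + 3 * k, by ring⟩, by rw [hk]; push_cast; ring⟩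
      · obtain ⟨k, hk⟩ : ∃ k : ℕ, a = 8 * k + 5 := ⟨a / 8, by lia⟩
        exact ⟨8 * k ^ 2 + 10 * k + 3, ⟨4 * k ^ 2 + 5 * k + 1, by ring⟩, by
          rw [hk]; push_cast; ring⟩
    have hord : orderOf ((a : ZMod (2 ^ (n + 4))) ^ 2) = 2 ^ (n + 1) := by
      have h := ZMod.orderOf_one_add_mul_prime_pow Nat.prime_two 3 (by lia) (by lia) c
        (by rwa [← Int.not_even_iff_odd, even_iff_two_dvd] at hc) (n + 1)
      have hcast : (a : ZMod (2 ^ (n + 4))) ^ 2 = 1 + (2 : ℕ) ^ 3 * c := by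
        exact_mod_cast congrArg (Int.cast : ℤ → ZMod (2 ^ (n + 4))) hsq
      rw [hcast]
      exact h
    rw [orderOf_pow' _ two_ne_zero] at hord
    rcases (Nat.dvd_prime Nat.prime_two).mp (Nat.gcd_dvd_right (orderOf (a : ZMod (2 ^ (n + 4)))) 2)
      with hgcd | hgcd
    · rw [hgcd, Nat.div_one] at hord
      rw [hord, pow_succ] at hgcd
      simp at hgcd
    · have hdvd := Nat.gcd_dvd_left (orderOf (a : ZMod (2 ^ (n + 4)))) 2
      rw [hgcd] at hord hdvd
      rw [← Nat.div_mul_cancel hdvd, hord, ← pow_succ]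

theorem Ideal.primesOver_span_natCast_eq (K : Type*) [Field K] [NumberField K] {p : ℕ}
    (hp : p.Prime) :
    (Ideal.span {(p : ℤ)}).primesOver (𝓞 K) =
      {P : Ideal (𝓞 K) | P.IsPrime ∧ (p : 𝓞 K) ∈ P} := by
  ext P
  refine and_congr_right fun hP => ?_
  rw [Ideal.liesOver_span_iff hP.ne_top (Nat.prime_iff_prime_int.mp hp)]
  simp

/-- For m ≥ 4, a rational prime p splits into exactly 2 primes in Q(ζ_{2^m})
iff p ≡ 3 or 5 (mod 8). -/
theorem stmt_1 (m : ℕ) (hm : 4 ≤ m) (K : Type*) [Field K] [NumberField K]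
    (ζ : K) (hζ : IsPrimitiveRoot ζ (2 ^ m)) (hK : IntermediateField.adjoin ℚ {ζ} = ⊤)
    (p : ℕ) (hp : p.Prime) :
    {P : Ideal (𝓞 K) | P.IsPrime ∧ (p : 𝓞 K) ∈ P}.ncard = 2 ↔
      (p % 8 = 3 ∨ p % 8 = 5) := by
  obtain ⟨n, rfl⟩ := Nat.exists_eq_add_of_le' hm
  have : Fact p.Prime := ⟨hp⟩
  have : IsCyclotomicExtension {2 ^ (n + 4)} ℚ K := by
    have h := hζ.intermediateField_adjoin_isCyclotomicExtension ℚ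
    rw [hK] at h
    exact IsCyclotomicExtension.equiv _ ℚ _ IntermediateField.topEquiv
  rw [← Ideal.primesOver_span_natCast_eq K hp]
  rcases hp.eq_two_or_odd' with rfl | hodd
  · have := IsCyclotomicExtension.Rat.ncard_primesOver_of_prime_pow 2 (n + 3) K
    rw [this]
    simp
  · have : IsGalois ℚ K := IsCyclotomicExtension.isGalois {2 ^ (n + 4)} ℚ K
    have hndvd : ¬ p ∣ 2 ^ (n + 4) := fun h => by
      have := (Nat.prime_dvd_prime_iff_eq hp Nat.prime_two).mp (hp.dvd_of_dvd_pow h)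
      subst this
      exact absurd hodd (by decide)
    have hmain := Ideal.ncard_primesOver_mul_ramificationIdxIn_mul_inertiaDegIn
      (Ideal.span {(p : ℤ)}) (𝓞 K) Gal(K/ℚ)
    rw [IsCyclotomicExtension.Rat.ramificationIdxIn_eq_of_not_dvd p K hndvd,
      IsCyclotomicExtension.Rat.inertiaDegIn_eq_of_not_dvd p K hndvd, one_mul,
      IsGaloisGroup.card_eq_finrank Gal(K/ℚ) ℚ K, IsCyclotomicExtension.Rat.finrank (2 ^ (n + 4)) K,
      Nat.totient_prime_pow_succ Nat.prime_two, Nat.add_one_sub_one, mul_one,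
      pow_succ' 2 (n + 2)] at hmain
    rw [← ZMod.orderOf_natCast_two_pow_eq_iff hodd n]
    constructor
    · intro h
      rw [h] at hmain
      exact Nat.eq_of_mul_eq_mul_left two_pos hmain
    · intro h
      rw [h] at hmain
      exact Nat.eq_of_mul_eq_mul_right (by positivity) hmain
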